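/- arXiv:math/0612048 — 2 statements merged into one kernel-verified Lean document; each statement's English description precedes it below -/
import Mathlib

section
/- Let c := sup_{k≥2} (w(k-1)+w(1))/w(k-1) (finite under (A0)). Then for every integer ℓ ≥ 1, one has (w(1)/c)·P^{1,1}(Z_∞ = 1)/w(ℓ) ≤ P^{1,1}(Z_{2ℓ} = ℓ) ≤ w(1)/w(ℓ). -/
/-!
Statement 0 (Proposition 2(a) of Cotar–Limic, "Attraction time for strongly
reinforced walks").

Setup: `w : ℕ → ℝ` is a reinforcement weight function, positive on `{1,2,...}`,
satisfying (A0): `∑_{k ≥ 1} 1/w(k) < ∞`.  The two-edge ERRW with law `P^{a,b}`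
is the Markov chain `(G_n, R_n)_{n ≥ a+b}` with `(G_{a+b}, R_{a+b}) = (a,b)`
which moves from `(g,r)` to `(g+1,r)` with probability `w(g)/(w(g)+w(r))` and to
`(g,r+1)` with probability `w(r)/(w(g)+w(r))`.  We encode a trajectory by the
sequence of choices `ω : ℕ → Bool` (`true` = green edge incremented), and we
characterize the law `P` by its values on cylinder sets.
-/

open MeasureTheory Finset

namespace AttractionTime

/-- Number of green increments among the first `i` steps. -/
def greenCount (ω : ℕ → Bool) (i : ℕ) : ℕ :=
  ((Finset.range i).filter fun j => ω j = true).card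

/-- Green edge weight after `i` steps, starting from `a`. -/
def Gw (a : ℕ) (ω : ℕ → Bool) (i : ℕ) : ℕ := a + greenCount ω i

/-- Red edge weight after `i` steps, starting from `b`. -/
def Rw (b : ℕ) (ω : ℕ → Bool) (i : ℕ) : ℕ := b + (i - greenCount ω i)

/-- Transition probability of the `i`-th step of the trajectory `s`. -/
noncomputable def stepProb (w : ℕ → ℝ) (a b : ℕ) (s : ℕ → Bool) (i : ℕ) : ℝ :=
  if s i then w (Gw a s i) / (w (Gw a s i) + w (Rw b s i))
  else w (Rw b s i) / (w (Gw a s i) + w (Rw b s i))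

/-- `Z_n = min (G_n, R_n)`, where time `n ≥ a+b` corresponds to `n - (a+b)` steps. -/
def Z (a b : ℕ) (ω : ℕ → Bool) (n : ℕ) : ℕ :=
  min (Gw a ω (n - (a + b))) (Rw b ω (n - (a + b)))

/-- `Z_∞ = sup_n Z_n ∈ ℕ ∪ {∞}`. -/
noncomputable def Zinf (a b : ℕ) (ω : ℕ → Bool) : ℕ∞ := ⨆ n, (Z a b ω n : ℕ∞)

/-- The law `P^{a,b}` : a probability measure on trajectories whose cylinder
probabilities are the products of the transition probabilities. -/
def IsTwoEdgeLaw (w : ℕ → ℝ) (a b : ℕ) (P : Measure (ℕ → Bool)) : Prop :=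
  ∀ (m : ℕ) (s : ℕ → Bool),
    (P {ω | ∀ i < m, ω i = s i}).toReal = ∏ i ∈ Finset.range m, stepProb w a b s i

end AttractionTime

open AttractionTime

namespace AttractionTime

lemma greenCount_succ (ω : ℕ → Bool) (i : ℕ) :
    greenCount ω (i + 1) = greenCount ω i + if ω i then 1 else 0 := by
  unfold greenCount
  rw [range_add_one, filter_insert]
  by_cases h : ω i = true <;> simp [h]

lemma greenCount_le (ω : ℕ → Bool) (i : ℕ) : greenCount ω i ≤ i :=
  (card_filter_le _ _).trans (card_range i).le

lemma greenCount_congr {s t : ℕ → Bool} {i : ℕ} (h : ∀ j < i, s j = t j) :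
    greenCount s i = greenCount t i := by
  unfold greenCount
  congr 1
  exact filter_congr fun j hj => by rw [h j (mem_range.1 hj)]

lemma stepProb_congr (w : ℕ → ℝ) (a b : ℕ) {s t : ℕ → Bool} {i : ℕ} (h : ∀ j ≤ i, s j = t j) :
    stepProb w a b s i = stepProb w a b t i := by
  unfold stepProb Gw Rw
  rw [greenCount_congr fun j hj => h j hj.le, h i le_rfl]

/-- The trajectory whose green steps are exactly those in `S`. -/
def trajectory (S : Finset ℕ) : ℕ → Bool := fun j => decide (j ∈ S)

lemma greenCount_trajectory {S : Finset ℕ} {m : ℕ} (hS : S ⊆ range m) :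
    greenCount (trajectory S) m = S.card := by
  unfold greenCount trajectory
  congr 1
  ext j
  simpa using fun hj => mem_range.1 (hS hj)

/-- The total weight of the trajectories having `k` green steps among the first `m`. -/
noncomputable def countProb (w : ℕ → ℝ) (a b m k : ℕ) : ℝ :=
  ∑ S ∈ powersetCard k (range m), ∏ i ∈ range m, stepProb w a b (trajectory S) i

lemma countProb_zero_zero (w : ℕ → ℝ) (a b : ℕ) : countProb w a b 0 0 = 1 := by
  simp [countProb]

lemma countProb_of_lt (w : ℕ → ℝ) (a b : ℕ) {m k : ℕ} (h : m < k) :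
    countProb w a b m k = 0 := by
  unfold countProb
  rw [powersetCard_eq_empty.2 (by simpa using h), sum_empty]

lemma prod_stepProb_trajectory (w : ℕ → ℝ) (a b : ℕ) {m k : ℕ} {S : Finset ℕ}
    (hS : S ∈ powersetCard k (range m)) :
    ∏ i ∈ range (m + 1), stepProb w a b (trajectory S) i =
      (∏ i ∈ range m, stepProb w a b (trajectory S) i) *
        (w (b + (m - k)) / (w (a + k) + w (b + (m - k)))) := by
  obtain ⟨hsub, rfl⟩ := mem_powersetCard.1 hS
  have hm : trajectory S m = false := by
    simpa [trajectory] using fun h => (mem_range.1 (hsub h)).false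
  rw [prod_range_succ]
  congr 1
  simp [stepProb, Gw, Rw, hm, greenCount_trajectory hsub]

lemma prod_stepProb_trajectory_insert (w : ℕ → ℝ) (a b : ℕ) {m k : ℕ} {S : Finset ℕ}
    (hS : S ∈ powersetCard k (range m)) :
    ∏ i ∈ range (m + 1), stepProb w a b (trajectory (insert m S)) i =
      (∏ i ∈ range m, stepProb w a b (trajectory S) i) *
        (w (a + k) / (w (a + k) + w (b + (m - k)))) := by
  obtain ⟨hsub, rfl⟩ := mem_powersetCard.1 hS
  have hlt : ∀ j < m, trajectory (insert m S) j = trajectory S j := fun j hj => by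
    simp [trajectory, hj.ne]
  have hm : trajectory (insert m S) m = true := by simp [trajectory]
  rw [prod_range_succ]
  congr 1
  · exact prod_congr rfl fun i hi =>
      stepProb_congr w a b fun j hj => hlt j (hj.trans_lt (mem_range.1 hi))
  · simp [stepProb, Gw, Rw, hm, greenCount_congr hlt, greenCount_trajectory hsub]

lemma countProb_succ_zero (w : ℕ → ℝ) (a b m : ℕ) :
    countProb w a b (m + 1) 0 =
      countProb w a b m 0 * (w (b + m) / (w a + w (b + m))) := by
  have h := prod_stepProb_trajectory w a b (m := m) (k := 0) (S := ∅) (by simp)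
  simpa [countProb] using h

lemma countProb_succ_succ (w : ℕ → ℝ) (a b m k : ℕ) :
    countProb w a b (m + 1) (k + 1) =
      countProb w a b m k * (w (a + k) / (w (a + k) + w (b + (m - k)))) +
      countProb w a b m (k + 1) *
        (w (b + (m - (k + 1))) / (w (a + (k + 1)) + w (b + (m - (k + 1))))) := by
  have hnot : ∀ {j} {S : Finset ℕ}, S ∈ powersetCard j (range m) → m ∉ S := fun hS h =>
    (mem_range.1 ((mem_powersetCard.1 hS).1 h)).false
  have hdisj : Disjoint (powersetCard (k + 1) (range m))
      ((powersetCard k (range m)).image (insert m)) := by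
    refine disjoint_left.2 fun S hS hS' => ?_
    obtain ⟨T, -, rfl⟩ := mem_image.1 hS'
    exact hnot hS (mem_insert_self _ _)
  have hinj : Set.InjOn (insert m) (powersetCard k (range m) : Set (Finset ℕ)) := by
    intro S hS T hT h
    rw [← erase_insert (hnot hS), ← erase_insert (hnot hT), h]
  unfold countProb
  rw [range_add_one, powersetCard_succ_insert notMem_range_self, sum_union hdisj,
    sum_image hinj, sum_mul, sum_mul, add_comm, ← range_add_one]
  congr 1
  · exact sum_congr rfl fun S hS => prod_stepProb_trajectory_insert w a b hS
  · exact sum_congr rfl fun S hS => prod_stepProb_trajectory w a b hS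

lemma measurableSet_cylinder (m : ℕ) (s : ℕ → Bool) :
    MeasurableSet {ω : ℕ → Bool | ∀ i < m, ω i = s i} := by
  simp only [Set.ofPred_forall]
  exact .iInter fun i => .iInter fun _ =>
    measurableSet_eq_fun (measurable_pi_apply i) measurable_const

lemma setOf_greenCount_eq (m k : ℕ) :
    {ω | greenCount ω m = k} =
      ⋃ S ∈ powersetCard k (range m), {ω | ∀ i < m, ω i = trajectory S i} := by
  ext ω
  simp only [Set.mem_ofPred_eq, Set.mem_iUnion, exists_prop]
  constructor
  · intro h
    refine ⟨(range m).filter fun j => ω j = true,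
      mem_powersetCard.2 ⟨filter_subset _ _, h⟩, fun i hi => ?_⟩
    simp [trajectory, hi]
  · rintro ⟨S, hS, h⟩
    obtain ⟨hsub, rfl⟩ := mem_powersetCard.1 hS
    rw [greenCount_congr h, greenCount_trajectory hsub]

lemma IsTwoEdgeLaw.toReal_greenCount_eq {w : ℕ → ℝ} {a b : ℕ} {P : Measure (ℕ → Bool)}
    [IsFiniteMeasure P] (hP : IsTwoEdgeLaw w a b P) (m k : ℕ) :
    (P {ω | greenCount ω m = k}).toReal = countProb w a b m k := by
  rw [setOf_greenCount_eq, measure_biUnion_finset,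
    ENNReal.toReal_sum fun _ _ => measure_ne_top _ _]
  · exact sum_congr rfl fun S _ => hP m _
  · intro S hS T hT hne
    refine Set.disjoint_left.2 fun ω h h' => hne ?_
    have hS := (mem_powersetCard.1 hS).1
    have hT := (mem_powersetCard.1 hT).1
    ext j
    by_cases hj : j < m
    · have := (h j hj).symm.trans (h' j hj)
      simpa [trajectory] using this
    · exact ⟨fun hm => absurd (mem_range.1 (hS hm)) hj, fun hm => absurd (mem_range.1 (hT hm)) hj⟩
  · exact fun S _ => measurableSet_cylinder m _

lemma setOf_Z_two_mul_eq {ℓ : ℕ} (hℓ : 1 ≤ ℓ) :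
    {ω | Z 1 1 ω (2 * ℓ) = ℓ} = {ω | greenCount ω ((ℓ - 1) + (ℓ - 1)) = ℓ - 1} := by
  ext ω
  have hle := greenCount_le ω ((ℓ - 1) + (ℓ - 1))
  have h : 2 * ℓ - (1 + 1) = (ℓ - 1) + (ℓ - 1) := by omega
  simp only [Set.mem_ofPred_eq, Z, Gw, Rw, h]
  omega

lemma setOf_Zinf_eq_one_subset (m : ℕ) :
    {ω | Zinf 1 1 ω = 1} ⊆ {ω | greenCount ω m = m} ∪ {ω | greenCount ω m = 0} := by
  intro ω (h : Zinf 1 1 ω = 1)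
  have hZ : (Z 1 1 ω (m + 2) : ℕ∞) ≤ 1 :=
    (le_iSup (fun n => (Z 1 1 ω n : ℕ∞)) (m + 2)).trans h.le
  have hZ : Z 1 1 ω (m + 2) ≤ 1 := by exact_mod_cast hZ
  have hle := greenCount_le ω m
  simp only [Z, Gw, Rw, Nat.reduceAdd, Nat.add_sub_cancel] at hZ
  simp only [Set.mem_union, Set.mem_ofPred_eq]
  omega

variable {w : ℕ → ℝ}

lemma countProb_one_one_self_succ (m : ℕ) :
    countProb w 1 1 (m + 1) (m + 1) =
      countProb w 1 1 m m * (w (1 + m) / (w (1 + m) + w 1)) := by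
  rw [countProb_succ_succ, countProb_of_lt w 1 1 m.lt_succ_self]
  simp

lemma countProb_one_one_zero_eq_self (m : ℕ) :
    countProb w 1 1 m 0 = countProb w 1 1 m m := by
  induction m with
  | zero => rfl
  | succ m ih => rw [countProb_succ_zero, countProb_one_one_self_succ, ih, add_comm (w 1)]

lemma countProb_one_one_interior (i j : ℕ) :
    countProb w 1 1 (i + 1 + (j + 1)) (i + 1) =
      countProb w 1 1 (i + (j + 1)) i * (w (1 + i) / (w (1 + i) + w (1 + (j + 1)))) +
      countProb w 1 1 (i + 1 + j) (i + 1) *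
        (w (1 + j) / (w (1 + (i + 1)) + w (1 + j))) := by
  have h := countProb_succ_succ w 1 1 (i + 1 + j) i
  rw [show i + 1 + j - i = j + 1 by omega, show i + 1 + j - (i + 1) = j by omega] at h
  rwa [show i + (j + 1) = i + 1 + j by ring]

/-- The function `(w 1 / 2) * (1 / w g + 1 / w r)` solves the forward equation of the chain at
interior points. It is the ratio of the forward transition weights to those of the
time-reversed walk. -/
noncomputable def reversalWeight (w : ℕ → ℝ) (i j : ℕ) : ℝ :=
  w 1 / 2 * (1 / w (1 + i) + 1 / w (1 + j))

lemma reversalWeight_mul (hw : ∀ k, 1 ≤ k → 0 < w k) (i j : ℕ) :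
    reversalWeight w i j * (w (1 + i) / (w (1 + i) + w (1 + j))) = w 1 / (2 * w (1 + j)) := by
  have hi := hw (1 + i) (by omega)
  have hj := hw (1 + j) (by omega)
  unfold reversalWeight
  field_simp
  ring

lemma reversalWeight_mul' (hw : ∀ k, 1 ≤ k → 0 < w k) (i j : ℕ) :
    reversalWeight w i j * (w (1 + j) / (w (1 + i) + w (1 + j))) = w 1 / (2 * w (1 + i)) := by
  have hi := hw (1 + i) (by omega)
  have hj := hw (1 + j) (by omega)
  unfold reversalWeight
  field_simp
  ring

lemma reversalWeight_eq_add (i j : ℕ) :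
    reversalWeight w i j = w 1 / (2 * w (1 + j)) + w 1 / (2 * w (1 + i)) := by
  unfold reversalWeight
  ring

lemma reversalWeight_comm (i j : ℕ) : reversalWeight w i j = reversalWeight w j i := by
  unfold reversalWeight
  ring

lemma countProb_self_le_reversalWeight (hw : ∀ k, 1 ≤ k → 0 < w k) (m : ℕ) :
    countProb w 1 1 m m ≤ reversalWeight w m 0 := by
  have h1 := hw 1 le_rfl
  induction m with
  | zero =>
    rw [countProb_zero_zero, reversalWeight]
    field_simp
    norm_num
  | succ m ih =>
    have hm := hw (1 + m) (by omega)
    have hm' := hw (1 + (m + 1)) (by omega)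
    rw [countProb_one_one_self_succ]
    calc _ ≤ reversalWeight w m 0 * (w (1 + m) / (w (1 + m) + w 1)) := by gcongr
      _ = w 1 / (2 * w 1) := reversalWeight_mul hw m 0
      _ ≤ _ := by
        rw [reversalWeight_eq_add]
        exact le_add_of_nonneg_right (by positivity)

lemma mul_reversalWeight_le_countProb_self (hw : ∀ k, 1 ≤ k → 0 < w k) {D : ℝ} {m : ℕ}
    (hD : D ≤ 2 * countProb w 1 1 (m + 1) (m + 1)) :
    D * reversalWeight w m 0 ≤ countProb w 1 1 m m := by
  have h1 := hw 1 le_rfl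
  have hm := hw (1 + m) (by omega)
  have hr : 0 ≤ reversalWeight w m 0 := by
    unfold reversalWeight
    positivity
  have hrm := reversalWeight_mul hw m 0
  rw [countProb_one_one_self_succ] at hD
  refine (mul_le_mul_of_nonneg_right hD hr).trans_eq ?_
  calc _ = 2 * countProb w 1 1 m m *
        (reversalWeight w m 0 * (w (1 + m) / (w (1 + m) + w (1 + 0)))) := by ring
    _ = _ := by
      rw [hrm]
      field_simp

lemma countProb_le_reversalWeight (hw : ∀ k, 1 ≤ k → 0 < w k) (i j : ℕ) :
    countProb w 1 1 (i + j) i ≤ reversalWeight w i j := by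
  induction i generalizing j with
  | zero =>
    rw [zero_add, countProb_one_one_zero_eq_self, reversalWeight_comm]
    exact countProb_self_le_reversalWeight hw j
  | succ i ihi =>
    induction j with
    | zero => exact countProb_self_le_reversalWeight hw (i + 1)
    | succ j ihj =>
      have := hw (1 + i) (by omega)
      have := hw (1 + j) (by omega)
      have := hw (1 + (i + 1)) (by omega)
      have := hw (1 + (j + 1)) (by omega)
      rw [countProb_one_one_interior, reversalWeight_eq_add, ← reversalWeight_mul hw i (j + 1),
        ← reversalWeight_mul' hw (i + 1) j]
      gcongr
      exact ihi (j + 1)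

lemma mul_reversalWeight_le_countProb (hw : ∀ k, 1 ≤ k → 0 < w k) {D : ℝ}
    (hD : ∀ m, D ≤ 2 * countProb w 1 1 m m) (i j : ℕ) :
    D * reversalWeight w i j ≤ countProb w 1 1 (i + j) i := by
  induction i generalizing j with
  | zero =>
    rw [zero_add, countProb_one_one_zero_eq_self, reversalWeight_comm]
    exact mul_reversalWeight_le_countProb_self hw (hD _)
  | succ i ihi =>
    induction j with
    | zero => exact mul_reversalWeight_le_countProb_self hw (hD _)
    | succ j ihj =>
      have := hw (1 + i) (by omega)
      have := hw (1 + j) (by omega)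
      have := hw (1 + (i + 1)) (by omega)
      have := hw (1 + (j + 1)) (by omega)
      rw [countProb_one_one_interior, reversalWeight_eq_add, ← reversalWeight_mul hw i (j + 1),
        ← reversalWeight_mul' hw (i + 1) j, mul_add, ← mul_assoc, ← mul_assoc]
      gcongr
      exact ihi (j + 1)

lemma IsTwoEdgeLaw.toReal_Zinf_eq_one_le {P : Measure (ℕ → Bool)} [IsFiniteMeasure P]
    (hP : IsTwoEdgeLaw w 1 1 P) (m : ℕ) :
    (P {ω | Zinf 1 1 ω = 1}).toReal ≤ 2 * countProb w 1 1 m m := by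
  calc _ ≤ (P {ω | greenCount ω m = m}).toReal + (P {ω | greenCount ω m = 0}).toReal := by
        rw [← ENNReal.toReal_add (measure_ne_top _ _) (measure_ne_top _ _)]
        exact ENNReal.toReal_mono (by simp)
          ((measure_mono (setOf_Zinf_eq_one_subset m)).trans (measure_union_le _ _))
    _ = _ := by
        rw [hP.toReal_greenCount_eq, hP.toReal_greenCount_eq, countProb_one_one_zero_eq_self]
        ring

/-- The supremum is `0` when the set is unbounded, and at least `2` (its element at `k = 2`)
otherwise. -/
lemma div_sSup_le (hw : ∀ k, 1 ≤ k → 0 < w k) :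
    w 1 / sSup {x : ℝ | ∃ k : ℕ, 2 ≤ k ∧ x = (w (k - 1) + w 1) / w (k - 1)} ≤ w 1 := by
  have h1 := hw 1 le_rfl
  by_cases hb : BddAbove {x : ℝ | ∃ k : ℕ, 2 ≤ k ∧ x = (w (k - 1) + w 1) / w (k - 1)}
  · have h2 : (w 1 + w 1) / w 1 ≤
        sSup {x : ℝ | ∃ k : ℕ, 2 ≤ k ∧ x = (w (k - 1) + w 1) / w (k - 1)} :=
      le_csSup hb ⟨2, le_rfl, rfl⟩
    refine div_le_self h1.le (le_trans ?_ h2)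
    rw [le_div_iff₀ h1]
    linarith
  · rw [Real.sSup_of_not_bddAbove hb, div_zero]
    exact h1.le

end AttractionTime

/-- Proposition 2(b): for `P = P^{1,1}`,
`c := sup_{k≥2} (w(k-1)+w(1))/w(k-1)` and every `ℓ ≥ 1`,
`(w(1)/c)·P(Z_∞=1)/w(ℓ) ≤ P(Z_{2ℓ} = ℓ) ≤ w(1)/w(ℓ)`. -/
theorem stmt1 (w : ℕ → ℝ) (hw : ∀ k, 1 ≤ k → 0 < w k)
    (hA0 : Summable fun k : ℕ => 1 / w (k + 1))
    (P : Measure (ℕ → Bool)) [IsProbabilityMeasure P]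
    (hP : IsTwoEdgeLaw w 1 1 P)
    (c : ℝ) (hc : c = sSup {x : ℝ | ∃ k : ℕ, 2 ≤ k ∧ x = (w (k - 1) + w 1) / w (k - 1)})
    (ℓ : ℕ) (hℓ : 1 ≤ ℓ) :
    w 1 / c * (P {ω | Zinf 1 1 ω = 1}).toReal / w ℓ
        ≤ (P {ω | Z 1 1 ω (2 * ℓ) = ℓ}).toReal ∧
      (P {ω | Z 1 1 ω (2 * ℓ) = ℓ}).toReal ≤ w 1 / w ℓ := by
  have h1 := hw 1 le_rfl
  have hwℓ := hw ℓ hℓ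
  have hr : reversalWeight w (ℓ - 1) (ℓ - 1) = w 1 / w ℓ := by
    rw [reversalWeight, Nat.add_sub_cancel' hℓ]
    ring
  rw [setOf_Z_two_mul_eq hℓ, hP.toReal_greenCount_eq, ← hr]
  refine ⟨?_, countProb_le_reversalWeight hw _ _⟩
  refine le_trans ?_ (mul_reversalWeight_le_countProb hw hP.toReal_Zinf_eq_one_le _ _)
  have hc1 : w 1 / c ≤ w 1 := hc ▸ div_sSup_le hw
  calc _ ≤ w 1 * (P {ω | Zinf 1 1 ω = 1}).toReal / w ℓ := by gcongr
    _ = _ := by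
      rw [hr]
      ring
end

section
/- Fix an odd integer a ≥ 1 and an even integer b ≥ 2, and let c̄(a,b) := max( sup_{k ≥ b, k even} (w(k)+w(a))/w(k), sup_{k ≥ a, k odd} (w(k)+w(b))/w(k) ) (finite under (A0)). Then for every integer k ≥ a+b with k ≡ a+b (mod 2) and every integer ℓ ≤ k/2 such that either (ℓ is odd, ℓ ≥ a and k-ℓ ≥ b) or (ℓ is even, ℓ ≥ b and k-ℓ ≥ a), one has (min(w(a),w(b))/c̄(a,b))·P̄^{a,b}(Z_∞ = a)·P̄^{a,b}(Z_∞ = b)·(w(k-ℓ)+w(ℓ))/(w(k-ℓ)w(ℓ)) ≤ P̄^{a,b}(Z_k = ℓ) ≤ (max(w(a),w(b)))·(w(k-ℓ)+w(ℓ))/(w(k-ℓ)w(ℓ)). -/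
/-!
Setup for the law `P̄^{a,b}` (Cotar–Limic, "Attraction time for strongly
reinforced walks"): the ERRW on the two-edge graph with vertices `-1, 0, 1`,
started at the central vertex `0` and observed at successive returns to `0`.
It is the Markov chain `(G_n, R_n)` indexed by `n ∈ {a+b, a+b+2, ...}` with
`(G_{a+b}, R_{a+b}) = (a,b)`, moving from `(g,r)` to `(g+2,r)` with probability
`w(g)/(w(g)+w(r))` and to `(g,r+2)` with probability `w(r)/(w(g)+w(r))`.
Trajectories are encoded by the sequence of choices `ω : ℕ → Bool` (`true` =
green edge incremented), and the law is characterized by cylinder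
probabilities.
-/

open MeasureTheory Finset

namespace AttractionTimeBar

/-- Number of green increments among the first `i` (double-)steps. -/
def greenCount (ω : ℕ → Bool) (i : ℕ) : ℕ :=
  ((Finset.range i).filter fun j => ω j = true).card

/-- Green edge weight after `i` double-steps, starting from `a`. -/
def Gw (a : ℕ) (ω : ℕ → Bool) (i : ℕ) : ℕ := a + 2 * greenCount ω i

/-- Red edge weight after `i` double-steps, starting from `b`. -/
def Rw (b : ℕ) (ω : ℕ → Bool) (i : ℕ) : ℕ := b + 2 * (i - greenCount ω i)

/-- Transition probability of the `i`-th double-step of the trajectory `s`. -/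
noncomputable def stepProb (w : ℕ → ℝ) (a b : ℕ) (s : ℕ → Bool) (i : ℕ) : ℝ :=
  if s i then w (Gw a s i) / (w (Gw a s i) + w (Rw b s i))
  else w (Rw b s i) / (w (Gw a s i) + w (Rw b s i))

/-- `Z_n = min (G_n, R_n)`, where the time `n ∈ {a+b, a+b+2, ...}` corresponds
to `(n - (a+b))/2` double-steps. -/
def Z (a b : ℕ) (ω : ℕ → Bool) (n : ℕ) : ℕ :=
  min (Gw a ω ((n - (a + b)) / 2)) (Rw b ω ((n - (a + b)) / 2))

/-- `Z_∞ = sup_n Z_n ∈ ℕ ∪ {∞}`. -/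
noncomputable def Zinf (a b : ℕ) (ω : ℕ → Bool) : ℕ∞ :=
  ⨆ i, (min (Gw a ω i) (Rw b ω i) : ℕ∞)

/-- The law `P̄^{a,b}` : a probability measure on trajectories whose cylinder
probabilities are the products of the transition probabilities. -/
def IsTwoEdgeBarLaw (w : ℕ → ℝ) (a b : ℕ) (P : Measure (ℕ → Bool)) : Prop :=
  ∀ (m : ℕ) (s : ℕ → Bool),
    (P {ω | ∀ i < m, ω i = s i}).toReal = ∏ i ∈ Finset.range m, stepProb w a b s i

end AttractionTimeBar

namespace AttractionTimeBar

lemma greenCount_succ (ω : ℕ → Bool) (i : ℕ) :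
    greenCount ω (i + 1) = greenCount ω i + if ω i = true then 1 else 0 := by
  unfold greenCount
  rw [Finset.range_add_one, Finset.filter_insert]
  split_ifs <;> simp

lemma greenCount_le (ω : ℕ → Bool) (i : ℕ) : greenCount ω i ≤ i :=
  (Finset.card_filter_le _ _).trans (Finset.card_range i).le

lemma greenCount_congr {ω ω' : ℕ → Bool} {i : ℕ} (h : ∀ j < i, ω j = ω' j) :
    greenCount ω i = greenCount ω' i := by
  unfold greenCount
  congr 1
  exact Finset.filter_congr fun j hj => by rw [h j (Finset.mem_range.mp hj)]

lemma Gw_mono (a : ℕ) (ω : ℕ → Bool) : Monotone (Gw a ω) :=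
  monotone_nat_of_le_succ fun i => by
    unfold Gw
    rw [greenCount_succ]
    lia

lemma Rw_mono (b : ℕ) (ω : ℕ → Bool) : Monotone (Rw b ω) :=
  monotone_nat_of_le_succ fun i => by
    unfold Rw
    rw [greenCount_succ]
    split_ifs <;> lia

/-- If the limiting minimum of two monotone sequences is `c`, and one of them avoids `c`,
then the other one never exceeds `c`. -/
lemma le_of_iSup_min_eq {f g : ℕ → ℕ} (hf : Monotone f) (hg : Monotone g) {c : ℕ}
    (hgc : ∀ i, g i ≠ c) (h : (⨆ i, (min (f i) (g i) : ℕ∞)) = c) (n : ℕ) : f n ≤ c := by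
  by_contra! hn
  have hle : ∀ i, min (f i) (g i) ≤ c := fun i => by
    rw [← Nat.cast_le (α := ℕ∞), (Nat.mono_cast (α := ℕ∞)).map_min, ← h]
    exact le_iSup (fun i => (min (f i) (g i) : ℕ∞)) i
  obtain ⟨i, hi⟩ : ∃ i, c ≤ g i := by
    by_contra! hlt
    have hc : 0 < c := (Nat.zero_le _).trans_lt (hlt 0)
    have : (⨆ i, (min (f i) (g i) : ℕ∞)) ≤ ((c - 1 : ℕ) : ℕ∞) := iSup_le fun i => by
      have := hlt i
      rw [← (Nat.mono_cast (α := ℕ∞)).map_min, Nat.cast_le]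
      lia
    rw [h, Nat.cast_le] at this
    lia
  have h1 := hf (le_max_left n i)
  have h2 := hg (le_max_right n i)
  have h3 := hle (max n i)
  have h4 := hgc i
  lia

lemma measurableSet_coord_eq (i : ℕ) (c : Bool) : MeasurableSet {ω : ℕ → Bool | ω i = c} :=
  measurableSet_eq_fun (measurable_pi_apply i) measurable_const

lemma measurableSet_cylinder (m : ℕ) (s : ℕ → Bool) :
    MeasurableSet {ω : ℕ → Bool | ∀ i < m, ω i = s i} := by
  have : {ω : ℕ → Bool | ∀ i < m, ω i = s i} = ⋂ i < m, {ω | ω i = s i} := by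
    ext; simp
  rw [this]
  exact .iInter fun i => .iInter fun _ => measurableSet_coord_eq i _

/-- Extension of a finite word by `false`. -/
def extendWord {i : ℕ} (s : Fin i → Bool) (n : ℕ) : Bool :=
  if h : n < i then s ⟨n, h⟩ else false

/-- Markov property at the level of the number of green steps. -/
lemma measureReal_greenCount_and_step {w : ℕ → ℝ} {a b : ℕ} {P : Measure (ℕ → Bool)}
    [IsProbabilityMeasure P] (hP : IsTwoEdgeBarLaw w a b P) (m n : ℕ) (c : Bool) :
    P.real {ω | greenCount ω (m + n) = m ∧ ω (m + n) = c} =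
      P.real {ω | greenCount ω (m + n) = m} *
        ((if c then w (a + 2 * m) else w (b + 2 * n)) / (w (a + 2 * m) + w (b + 2 * n))) := by
  set i := m + n with hi
  let C (s : ℕ → Bool) : Set (ℕ → Bool) := {ω | ∀ j < i, ω j = s j}
  let S : Finset (Fin i → Bool) := {s | greenCount (extendWord s) i = m}
  have hext : ∀ ω : ℕ → Bool, ω ∈ C (extendWord fun x : Fin i => ω x) := fun ω j hj => by
    simp [extendWord, hj]
  have hdisj : ∀ s t : Fin i → Bool, s ≠ t → Disjoint (C (extendWord s)) (C (extendWord t)) := by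
    intro s t hst
    rw [Set.disjoint_left]
    refine fun ω hs ht => hst (funext fun x => ?_)
    have h1 := hs x x.2
    have h2 := ht x x.2
    simp only [extendWord, x.2, dif_pos] at h1 h2
    exact h1.symm.trans h2
  have hstep : ∀ s ∈ S, P.real (C (extendWord s) ∩ {ω | ω i = c}) =
      P.real (C (extendWord s)) *
        ((if c then w (a + 2 * m) else w (b + 2 * n)) / (w (a + 2 * m) + w (b + 2 * n))) := by
    intro s hs
    let t := Function.update (extendWord s) i c
    have hti : t i = c := Function.update_self ..
    have ht : ∀ j < i, t j = extendWord s j := fun j hj => Function.update_of_ne hj.ne _ _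
    have hCt : C (extendWord s) = {ω | ∀ j < i, ω j = t j} := by
      ext ω
      exact forall₂_congr fun j hj => by rw [ht j hj]
    have hCt' : C (extendWord s) ∩ {ω | ω i = c} = {ω | ∀ j < i + 1, ω j = t j} := by
      ext ω
      rw [hCt]
      simp only [Set.mem_inter_iff, Set.mem_ofPred_eq, Nat.forall_lt_succ_right, hti]
    have hgc : greenCount t i = m := (greenCount_congr ht).trans (Finset.mem_filter.mp hs).2
    have hs1 := hP (i + 1) t
    rw [Finset.prod_range_succ, ← hP i t] at hs1
    rw [hCt', hCt]
    refine hs1.trans ?_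
    congr 1
    have hin : i - m = n := by lia
    rw [stepProb, hti, Gw, Rw, hgc, hin]
    cases c <;> simp
  have h1 : {ω | greenCount ω i = m} = ⋃ s ∈ S, C (extendWord s) := by
    ext ω
    simp only [Set.mem_ofPred_eq, Set.mem_iUnion, exists_prop]
    refine ⟨fun h => ⟨_, ?_, hext ω⟩, fun ⟨s, hs, hω⟩ => ?_⟩
    · exact Finset.mem_filter.mpr ⟨Finset.mem_univ _, (greenCount_congr (hext ω)).symm.trans h⟩
    · exact (greenCount_congr hω).trans (Finset.mem_filter.mp hs).2
  have h2 : {ω | greenCount ω i = m ∧ ω i = c} =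
      ⋃ s ∈ S, (C (extendWord s) ∩ {ω | ω i = c}) := by
    rw [Set.ofPred_and, h1, Set.iUnion₂_inter]
  rw [h2, h1, measureReal_biUnion_finset
      (fun s _ t _ hst => (hdisj s t hst).mono Set.inter_subset_left Set.inter_subset_left)
      (fun s _ => (measurableSet_cylinder i _).inter (measurableSet_coord_eq i c)),
    measureReal_biUnion_finset (fun s _ t _ hst => hdisj s t hst)
      (fun s _ => measurableSet_cylinder i _), Finset.sum_mul]
  exact Finset.sum_congr rfl hstep

/-- Probability that the chain visits the state reached by `m` green and `n` red increments. -/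
noncomputable def visitProb (P : Measure (ℕ → Bool)) (m n : ℕ) : ℝ :=
  P.real {ω | greenCount ω (m + n) = m}

section Recurrence

variable {w : ℕ → ℝ} {a b : ℕ} {P : Measure (ℕ → Bool)} [IsProbabilityMeasure P]

lemma visitProb_zero_succ (hP : IsTwoEdgeBarLaw w a b P) (n : ℕ) :
    visitProb P 0 (n + 1) =
      visitProb P 0 n * (w (b + 2 * n) / (w a + w (b + 2 * n))) := by
  have h := measureReal_greenCount_and_step hP 0 n false
  simp only [Bool.false_eq_true, if_false, mul_zero, add_zero] at h
  rw [visitProb, visitProb, ← h]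
  congr 1
  ext ω
  have := greenCount_succ ω (0 + n)
  simp only [Set.mem_ofPred_eq, ← add_assoc, this]
  cases ω (0 + n) <;> simp

lemma visitProb_succ_zero (hP : IsTwoEdgeBarLaw w a b P) (m : ℕ) :
    visitProb P (m + 1) 0 =
      visitProb P m 0 * (w (a + 2 * m) / (w (a + 2 * m) + w b)) := by
  have h := measureReal_greenCount_and_step hP m 0 true
  simp only [if_true, mul_zero, add_zero] at h
  rw [visitProb, visitProb]
  simp only [add_zero]
  rw [← h]
  congr 1
  ext ω
  have h1 := greenCount_succ ω m
  have h2 := greenCount_le ω m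
  simp only [Set.mem_ofPred_eq, h1]
  cases ω m <;> simp
  lia

lemma visitProb_succ_succ (hP : IsTwoEdgeBarLaw w a b P) (m n : ℕ) :
    visitProb P (m + 1) (n + 1) =
      visitProb P m (n + 1) *
        (w (a + 2 * m) / (w (a + 2 * m) + w (b + 2 * (n + 1)))) +
      visitProb P (m + 1) n *
        (w (b + 2 * n) / (w (a + 2 * (m + 1)) + w (b + 2 * n))) := by
  have h1 := measureReal_greenCount_and_step hP m (n + 1) true
  have h2 := measureReal_greenCount_and_step hP (m + 1) n false
  have hi : m + 1 + n = m + (n + 1) := by ring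
  simp only [if_true] at h1
  simp only [Bool.false_eq_true, if_false] at h2
  rw [visitProb, visitProb, visitProb, ← h1, ← h2, hi,
    ← measureReal_inter_add_sdiff (s := {ω | greenCount ω (m + 1 + (n + 1)) = m + 1})
      (measurableSet_coord_eq (m + (n + 1)) true)]
  have hgc : ∀ ω, greenCount ω (m + 1 + (n + 1)) =
      greenCount ω (m + (n + 1)) + if ω (m + (n + 1)) = true then 1 else 0 := fun ω => by
    rw [← greenCount_succ]
    congr 1
    ring
  congr 2
  · ext ω
    simp only [Set.mem_inter_iff, Set.mem_ofPred_eq, hgc]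
    cases ω (m + (n + 1)) <;> simp
  · ext ω
    simp only [Set.mem_sdiff, Set.mem_ofPred_eq, hgc]
    cases ω (m + (n + 1)) <;> simp

/-- The normalized visit probability satisfies an averaging property in the interior, so it
is controlled by its boundary values. -/
lemma visitProb_mul_bounds (hw : ∀ k, 1 ≤ k → 0 < w k) (ha : 1 ≤ a) (hb : 1 ≤ b)
    (hP : IsTwoEdgeBarLaw w a b P) {x : ℝ}
    (hA : ∀ n, x ≤ w a * visitProb P 0 n) (hB : ∀ m, x ≤ w b * visitProb P m 0) (m n : ℕ) :
    visitProb P m n *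
        (w (a + 2 * m) * w (b + 2 * n) / (w (a + 2 * m) + w (b + 2 * n))) ∈
      Set.Icc x (max (w a) (w b)) := by
  have hwa := hw a ha
  have hwb := hw b hb
  have hzero : ∀ n, visitProb P 0 n * (w a * w (b + 2 * n) / (w a + w (b + 2 * n))) =
      w a * visitProb P 0 (n + 1) := fun n => by rw [visitProb_zero_succ hP]; ring
  have hzero' : ∀ m, visitProb P m 0 * (w (a + 2 * m) * w b / (w (a + 2 * m) + w b)) =
      w b * visitProb P (m + 1) 0 := fun m => by rw [visitProb_succ_zero hP]; ring
  have hle : ∀ m n, visitProb P m n ≤ 1 := fun m n => measureReal_le_one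
  induction m generalizing n with
  | zero =>
    rw [mul_zero, add_zero, hzero]
    exact ⟨hA _, (mul_le_of_le_one_right hwa.le (hle _ _)).trans (le_max_left _ _)⟩
  | succ m ihm =>
    induction n with
    | zero =>
      rw [mul_zero, add_zero, hzero']
      exact ⟨hB _, (mul_le_of_le_one_right hwb.le (hle _ _)).trans (le_max_right _ _)⟩
    | succ n ihn =>
      have hg : 0 < w (a + 2 * (m + 1)) := hw _ (by lia)
      have hg' : 0 < w (a + 2 * m) := hw _ (by lia)
      have hr : 0 < w (b + 2 * (n + 1)) := hw _ (by lia)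
      have hr' : 0 < w (b + 2 * n) := hw _ (by lia)
      have hconv := convex_Icc x (max (w a) (w b)) (ihm (n + 1)) ihn
        (a := w (a + 2 * (m + 1)) / (w (a + 2 * (m + 1)) + w (b + 2 * (n + 1))))
        (b := w (b + 2 * (n + 1)) / (w (a + 2 * (m + 1)) + w (b + 2 * (n + 1))))
        (by positivity) (by positivity) (by field_simp)
      convert hconv using 1
      rw [visitProb_succ_succ hP, smul_eq_mul, smul_eq_mul]
      ring

end Recurrence

end AttractionTimeBar

open AttractionTimeBar

/-- Theorem 4 (second part): for `P = P̄^{a,b}` with `a` odd and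
`b` even, `c̄(a,b) := max(sup_{k ≥ b even} (w(k)+w(a))/w(k),
sup_{k ≥ a odd} (w(k)+w(b))/w(k))`, every `k ≥ a+b` with `k ≡ a+b (mod 2)` and
every `ℓ ≤ k/2` with the stated parity conditions,
`(min(w(a),w(b))/c̄(a,b))·P̄(Z_∞=a)·P̄(Z_∞=b)·(w(k-ℓ)+w(ℓ))/(w(k-ℓ)w(ℓ))
  ≤ P̄(Z_k = ℓ) ≤ max(w(a),w(b))·(w(k-ℓ)+w(ℓ))/(w(k-ℓ)w(ℓ))`. -/
theorem stmt4 (w : ℕ → ℝ) (hw : ∀ k, 1 ≤ k → 0 < w k)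
    (hA0 : Summable fun k : ℕ => 1 / w (k + 1))
    (a b : ℕ) (ha : 1 ≤ a) (haodd : Odd a) (hb : 2 ≤ b) (hbeven : Even b)
    (P : Measure (ℕ → Bool)) [IsProbabilityMeasure P]
    (hP : IsTwoEdgeBarLaw w a b P)
    (cbar : ℝ)
    (hcbar : cbar =
      max (sSup {x : ℝ | ∃ k : ℕ, b ≤ k ∧ Even k ∧ x = (w k + w a) / w k})
        (sSup {x : ℝ | ∃ k : ℕ, a ≤ k ∧ Odd k ∧ x = (w k + w b) / w k}))
    (k ℓ : ℕ) (hk : a + b ≤ k) (hkpar : k % 2 = (a + b) % 2) (hℓ : 2 * ℓ ≤ k)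
    (hcase : (Odd ℓ ∧ a ≤ ℓ ∧ b ≤ k - ℓ) ∨ (Even ℓ ∧ b ≤ ℓ ∧ a ≤ k - ℓ)) :
    min (w a) (w b) / cbar * (P {ω | Zinf a b ω = (a : ℕ)}).toReal *
        (P {ω | Zinf a b ω = (b : ℕ)}).toReal *
        ((w (k - ℓ) + w ℓ) / (w (k - ℓ) * w ℓ))
        ≤ (P {ω | Z a b ω k = ℓ}).toReal ∧
      (P {ω | Z a b ω k = ℓ}).toReal
        ≤ max (w a) (w b) * ((w (k - ℓ) + w ℓ) / (w (k - ℓ) * w ℓ)) := by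
  have hwa : 0 < w a := hw a ha
  have hwb : 0 < w b := hw b (by lia)
  set A := (P {ω | Zinf a b ω = (a : ℕ)}).toReal
  set B := (P {ω | Zinf a b ω = (b : ℕ)}).toReal
  have hA0' : 0 ≤ A := ENNReal.toReal_nonneg
  have hB0' : 0 ≤ B := ENNReal.toReal_nonneg
  have hA1 : A ≤ 1 := measureReal_le_one
  have hB1 : B ≤ 1 := measureReal_le_one
  have hA : ∀ n, A ≤ visitProb P 0 n := fun n => measureReal_mono fun ω hω => by
    have hne : ∀ i, Rw b ω i ≠ a := fun i => by unfold Rw; grind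
    have := le_of_iSup_min_eq (Gw_mono a ω) (Rw_mono b ω) hne hω (0 + n)
    unfold Gw at this
    simp only [Set.mem_ofPred_eq]
    lia
  have hB : ∀ m, B ≤ visitProb P m 0 := fun m => measureReal_mono fun ω hω => by
    have hne : ∀ i, Gw a ω i ≠ b := fun i => by unfold Gw; grind
    have hω' : (⨆ i, (min (Rw b ω i) (Gw a ω i) : ℕ∞)) = b := by
      simp_rw [min_comm (Rw b ω _ : ℕ∞)]
      exact hω
    have := le_of_iSup_min_eq (Rw_mono b ω) (Gw_mono a ω) hne hω' (m + 0)
    have := greenCount_le ω (m + 0)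
    unfold Rw at *
    simp only [Set.mem_ofPred_eq]
    lia
  have hmin : 0 < min (w a) (w b) := lt_min hwa hwb
  have hsSup : ∀ S : Set ℝ, (∃ x ∈ S, 1 ≤ x) → sSup S = 0 ∨ 1 ≤ sSup S := by
    rintro S ⟨x, hx, h1⟩
    by_cases hS : BddAbove S
    · exact .inr (h1.trans (le_csSup hS hx))
    · exact .inl (Real.sSup_of_not_bddAbove hS)
  have hone : ∀ x y : ℝ, 0 < x → 0 < y → 1 ≤ (x + y) / x := fun x y hx hy => by
    rw [le_div_iff₀ hx]; linarith
  have hc : 0 ≤ cbar⁻¹ ∧ cbar⁻¹ ≤ 1 := by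
    have h : cbar = 0 ∨ 1 ≤ cbar := by
      rw [hcbar]
      rcases hsSup {x | ∃ k, b ≤ k ∧ Even k ∧ x = (w k + w a) / w k}
          ⟨_, ⟨b, le_rfl, hbeven, rfl⟩, hone _ _ hwb hwa⟩ with h1 | h1
      · rcases hsSup {x | ∃ k, a ≤ k ∧ Odd k ∧ x = (w k + w b) / w k}
            ⟨_, ⟨a, le_rfl, haodd, rfl⟩, hone _ _ hwa hwb⟩ with h2 | h2
        · rw [h1, h2, max_self]; exact .inl rfl
        · exact .inr (le_max_of_le_right h2)
      · exact .inr (le_max_of_le_left h1)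
    rcases h with h | h
    · simp [h]
    · exact ⟨by positivity, inv_le_one_of_one_le₀ h⟩
  have hbounds := visitProb_mul_bounds hw ha (by lia) hP
    (x := min (w a) (w b) / cbar * A * B)
    (fun n => calc
      min (w a) (w b) / cbar * A * B = min (w a) (w b) * A * (cbar⁻¹ * B) := by ring
      _ ≤ min (w a) (w b) * A * 1 := by gcongr; exact mul_le_one₀ hc.2 hB0' hB1
      _ ≤ w a * visitProb P 0 n := by
        rw [mul_one]; gcongr
        · exact min_le_left _ _
        · exact hA n)
    (fun m => calc
      min (w a) (w b) / cbar * A * B = min (w a) (w b) * B * (cbar⁻¹ * A) := by ring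
      _ ≤ min (w a) (w b) * B * 1 := by gcongr; exact mul_le_one₀ hc.2 hA0' hA1
      _ ≤ w b * visitProb P m 0 := by
        rw [mul_one]; gcongr
        · exact min_le_right _ _
        · exact hB m)
  have hfinal : ∀ m n, (P {ω | Z a b ω k = ℓ}).toReal = visitProb P m n →
      (w (k - ℓ) + w ℓ) / (w (k - ℓ) * w ℓ) =
        (w (a + 2 * m) * w (b + 2 * n) / (w (a + 2 * m) + w (b + 2 * n)))⁻¹ →
      min (w a) (w b) / cbar * A * B * ((w (k - ℓ) + w ℓ) / (w (k - ℓ) * w ℓ))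
          ≤ (P {ω | Z a b ω k = ℓ}).toReal ∧
        (P {ω | Z a b ω k = ℓ}).toReal
          ≤ max (w a) (w b) * ((w (k - ℓ) + w ℓ) / (w (k - ℓ) * w ℓ)) := by
    intro m n h1 h2
    have hg : 0 < w (a + 2 * m) := hw _ (by lia)
    have hr : 0 < w (b + 2 * n) := hw _ (by lia)
    have hpos : 0 < w (a + 2 * m) * w (b + 2 * n) / (w (a + 2 * m) + w (b + 2 * n)) := by
      positivity
    rw [h1, h2, mul_inv_le_iff₀ hpos, le_mul_inv_iff₀ hpos]
    exact hbounds m n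
  rcases hcase with ⟨hpar, h1, h2⟩ | ⟨hpar, h1, h2⟩
  · obtain ⟨m, hm⟩ : ∃ m, ℓ = a + 2 * m := ⟨(ℓ - a) / 2, by grind⟩
    obtain ⟨n, hn⟩ : ∃ n, k - ℓ = b + 2 * n := ⟨(k - ℓ - b) / 2, by grind⟩
    refine hfinal m n ?_ ?_
    · refine congrArg P.real (Set.ext fun ω => ?_)
      have hi : (k - (a + b)) / 2 = m + n := by lia
      have := greenCount_le ω (m + n)
      simp only [Set.mem_ofPred_eq, Z, Gw, Rw, hi]
      rw [Nat.odd_iff] at haodd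
      rw [Nat.even_iff] at hbeven
      omega
    · rw [hn, hm, inv_div, add_comm, mul_comm (w (b + 2 * n))]
  · obtain ⟨n, hn⟩ : ∃ n, ℓ = b + 2 * n := ⟨(ℓ - b) / 2, by grind⟩
    obtain ⟨m, hm⟩ : ∃ m, k - ℓ = a + 2 * m := ⟨(k - ℓ - a) / 2, by grind⟩
    refine hfinal m n ?_ ?_
    · refine congrArg P.real (Set.ext fun ω => ?_)
      have hi : (k - (a + b)) / 2 = m + n := by lia
      have := greenCount_le ω (m + n)
      simp only [Set.mem_ofPred_eq, Z, Gw, Rw, hi]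
      rw [Nat.odd_iff] at haodd
      rw [Nat.even_iff] at hbeven
      omega
    · rw [hm, hn, inv_div]
end
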